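/- Let (α_n)_n ⊂ (0,1], (γ_n)_n ⊂ [1,∞), (C_n)_n ⊂ [1,∞) and (r_n)_n ⊂ (0,∞) be sequences with α_n → 1, γ_n → 1, C_n → 1 and r_n → 0. Let (X,d) be a separable metric space directionally (ξ,η,ζ)-limited at X, endowed for each n with an asymptotically (α_n,γ_n)-bounded Borel measure ν_n. Let μ be a positive, outer regular Borel measure on X and let q be a premeasure on closed balls satisfying C_n^{-1} μ(B_{α_n r}(x)) ≤ q(B_r(x)) ≤ C_n μ(B_r(x)) for all x ∈ X, all n ∈ ℕ and all 0 < r < r_n. Then the packing construction recovers μ exactly: ĥμ^q(A) = μ(A) for every Borel set A ⊂ X. -/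

import Mathlib

open MeasureTheory Metric Set Filter Topology ENNReal Bornology

/-- `(X,d)` is directionally `(ξ,η,ζ)`-limited at `A`: for every `a ∈ A` and every
`B ⊆ A ∩ (U_ξ(a) \ {a})` such that for all distinct `b, c ∈ B` with `d(a,b) ≥ d(a,c)`,
every `x` with `d(a,x) = d(a,c)` and `d(a,x) + d(x,b) = d(a,b)` satisfies
`d(x,c)/d(a,c) ≥ η`, the set `B` has cardinality at most `ζ`. -/
def DirLimited {X : Type*} [MetricSpace X] (A : Set X) (ξ η : ℝ) (ζ : ℕ) : Prop :=
  ∀ a ∈ A, ∀ B : Set X, B ⊆ A ∩ (Metric.ball a ξ \ {a}) →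
    (∀ b ∈ B, ∀ c ∈ B, b ≠ c → dist a c ≤ dist a b →
      ∀ x : X, dist a x = dist a c → dist a x + dist x b = dist a b →
        η ≤ dist x c / dist a c) →
    B.Finite ∧ B.ncard ≤ ζ
/-- `ν` is asymptotically `(α,γ)`-bounded: finite on bounded sets, strictly positive on
balls of positive radius, and `limsup_{r→0⁺} ν(B_r(x))/ν(B_{αr}(x)) ≤ γ` for all `x`. -/
def AsympBounded {X : Type*} [MetricSpace X] [MeasurableSpace X]
    (ν : MeasureTheory.Measure X) (α γ : ℝ) : Prop :=
  (∀ s : Set X, Bornology.IsBounded s → ν s < ⊤) ∧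
  (∀ (x : X) (r : ℝ), 0 < r → 0 < ν (Metric.closedBall x r)) ∧
  (∀ x : X, Filter.limsup
      (fun r : ℝ => ν (Metric.closedBall x r) / ν (Metric.closedBall x (α * r)))
      (nhdsWithin 0 (Set.Ioi 0)) ≤ ENNReal.ofReal γ)
/-- A packing of the open set `U` of order `δ`: a countable family of pairwise disjoint
closed balls, each of positive radius at most `δ` and contained in `U`, encoded as a
countable set of (center, radius) pairs. -/
def IsPackingOf {X : Type*} [MetricSpace X] (U : Set X) (δ : ℝ) (P : Set (X × ℝ)) : Prop :=
  P.Countable ∧ (∀ p ∈ P, 0 < p.2 ∧ p.2 ≤ δ ∧ Metric.closedBall p.1 p.2 ⊆ U) ∧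
  P.Pairwise fun p p' => Disjoint (Metric.closedBall p.1 p.2) (Metric.closedBall p'.1 p'.2)

/-- `ĥμ^q_δ(U)`: supremum of `∑_{B ∈ ℱ} q(B)` over packings `ℱ` of `U` of order `δ`. -/
noncomputable def packPre {X : Type*} [MetricSpace X] (q : X → ℝ → ℝ≥0∞) (δ : ℝ)
    (U : Set X) : ℝ≥0∞ :=
  ⨆ (P : Set (X × ℝ)) (_ : IsPackingOf U δ P), ∑' p : P, q p.1.1 p.1.2

/-- `ĥμ^q(U) = inf_{δ>0} ĥμ^q_δ(U)` for `U` open. -/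
noncomputable def packOpen {X : Type*} [MetricSpace X] (q : X → ℝ → ℝ≥0∞)
    (U : Set X) : ℝ≥0∞ :=
  ⨅ (δ : ℝ) (_ : 0 < δ), packPre q δ U

/-- The packing construction extended to arbitrary sets:
`ĥμ^q(A) = inf { ĥμ^q(U) : A ⊆ U, U open }`. -/
noncomputable def packM {X : Type*} [MetricSpace X] (q : X → ℝ → ℝ≥0∞)
    (A : Set X) : ℝ≥0∞ :=
  ⨅ (U : Set X) (_ : IsOpen U) (_ : A ⊆ U), packOpen q U

/-- In a directionally limited space, satellite configurations whose centers lie in a set of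
small diameter have boundedly many points. -/
theorem DirLimited.isEmpty_satelliteConfig {X : Type*} [MetricSpace X] {ξ η : ℝ} {ζ : ℕ}
    (hη' : η ≤ 1 / 3) (hdir : DirLimited (Set.univ : Set X) ξ η ζ) {s : Set X}
    (hs : ∀ x ∈ s, ∀ y ∈ s, dist x y < ξ) :
    IsEmpty (Besicovitch.SatelliteConfig s (13 * ζ + 1) (7 / 6)) := by
  classical
  refine ⟨fun S => ?_⟩
  set L : Fin (13 * ζ + 1).succ := Fin.last _ with hL
  set x₀ : X := (S.c L : X) with hx₀
  set r : ℝ := S.r L with hr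
  have hrpos : 0 < r := S.rpos L
  set C : Fin (13 * ζ + 1) → X := fun i => (S.c i.castSucc : X) with hC
  set ρ : Fin (13 * ζ + 1) → ℝ := fun i => S.r i.castSucc with hρ
  have hρpos : ∀ i, 0 < ρ i := fun i => S.rpos _
  have hlt : ∀ i : Fin (13 * ζ + 1), i.castSucc < L := fun i => Fin.castSucc_lt_last i
  have hlow : ∀ i, ρ i ≤ dist x₀ (C i) := fun i => by
    have := (S.hlast _ (hlt i)).1
    rwa [Subtype.dist_eq, dist_comm] at this
  have hratio : ∀ i, r ≤ 7 / 6 * ρ i := fun i => (S.hlast _ (hlt i)).2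
  have hup : ∀ i, dist x₀ (C i) ≤ ρ i + r := fun i => by
    have := S.inter _ (hlt i)
    rwa [Subtype.dist_eq, dist_comm] at this
  have hpair : ∀ i j, i ≠ j → (ρ i ≤ dist (C i) (C j) ∧ ρ j ≤ 7 / 6 * ρ i) ∨
      (ρ j ≤ dist (C i) (C j) ∧ ρ i ≤ 7 / 6 * ρ j) := fun i j hij => by
    have h1 : i.castSucc ≠ j.castSucc := fun h => hij (Fin.castSucc_injective _ h)
    rcases S.h h1 with h | h
    · left; exact h
    · right; refine ⟨?_, h.2⟩
      have := h.1
      rwa [dist_comm] at this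
  have hinj : Function.Injective C := fun i j h => by
    by_contra hij
    have h0 : dist (C i) (C j) = 0 := by rw [h, dist_self]
    rcases hpair i j hij with h1 | h1
    · linarith [hρpos i, h1.1]
    · linarith [hρpos j, h1.1]
  have hfl : ∀ i, dist x₀ (C i) < 2 * r → ⌊6 * dist x₀ (C i) / r⌋₊ < 12 := fun i hi => by
    rw [Nat.floor_lt (by positivity), div_lt_iff₀ hrpos]
    push_cast; linarith
  let col : Fin (13 * ζ + 1) → Fin 13 := fun i =>
    if h : dist x₀ (C i) < 2 * r then
      ⟨⌊6 * dist x₀ (C i) / r⌋₊, (hfl i h).trans (by norm_num)⟩ else 12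
  obtain ⟨y, hy⟩ := Fintype.exists_lt_card_fiber_of_mul_lt_card (f := col) (n := ζ) (by simp)
  set F : Finset (Fin (13 * ζ + 1)) := {i | col i = y} with hF
  have hmain := hdir x₀ (mem_univ _) (C '' F) ?_ ?_
  · have := hmain.2
    rw [Set.ncard_image_of_injective _ hinj, Set.ncard_coe_finset] at this
    omega
  · rintro _ ⟨i, -, rfl⟩
    refine ⟨mem_univ _, ?_, ?_⟩
    · rw [Metric.mem_ball]
      exact hs _ (S.c _).2 _ (S.c _).2
    · intro h
      have h0 : C i = x₀ := h
      have := hlow i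
      rw [h0, dist_self] at this
      linarith [hρpos i]
  · rintro _ ⟨i, hi, rfl⟩ _ ⟨j, hj, rfl⟩ hne hle x hx1 hx2
    have hij : i ≠ j := fun h => hne (by rw [h])
    have hcol : col i = col j := by
      have h1 : col i = y := by simpa [hF] using hi
      have h2 : col j = y := by simpa [hF] using hj
      rw [h1, h2]
    have hjpos : 0 < dist x₀ (C j) := (hρpos j).trans_le (hlow j)
    rw [le_div_iff₀ hjpos]
    have htri : dist (C i) (C j) ≤ dist x (C i) + dist x (C j) := by
      rw [dist_comm x (C i)]; exact dist_triangle _ _ _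
    have hηj : η * dist x₀ (C j) ≤ 1 / 3 * dist x₀ (C j) := by gcongr
    by_cases hjn : dist x₀ (C j) < 2 * r
    · have hin : dist x₀ (C i) < 2 * r := by
        by_contra hin
        simp only [col, hin, hjn, dif_pos, dif_neg, not_false_iff] at hcol
        have h1 := hfl j hjn
        have h2 := congrArg Fin.val hcol
        simp only at h2
        rw [← h2] at h1
        exact absurd h1 (by decide)
      simp only [col, hin, hjn, dif_pos, Fin.mk.injEq] at hcol
      have h1 : 6 * dist x₀ (C i) / r < ⌊6 * dist x₀ (C i) / r⌋₊ + 1 := Nat.lt_floor_add_one _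
      have h2 : (⌊6 * dist x₀ (C j) / r⌋₊ : ℝ) ≤ 6 * dist x₀ (C j) / r :=
        Nat.floor_le (by positivity)
      rw [← hcol] at h2
      have h3 : 6 * dist x₀ (C i) / r < 6 * dist x₀ (C j) / r + 1 := by linarith
      rw [div_lt_iff₀ hrpos, add_mul, div_mul_cancel₀ _ hrpos.ne'] at h3
      have h4 : 6 / 7 * r ≤ dist (C i) (C j) := by
        rcases hpair i j hij with h | h
        · linarith [hratio i]
        · linarith [hratio j]
      linarith
    · push Not at hjn
      rcases hpair i j hij with h | h
      · linarith [hup i]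
      · linarith [hup i, hlow j]

theorem DirLimited.hasBesicovitchCovering {X : Type*} [MetricSpace X] {ξ η : ℝ} {ζ : ℕ}
    (hη' : η ≤ 1 / 3) (hdir : DirLimited (Set.univ : Set X) ξ η ζ) {s : Set X}
    (hs : ∀ x ∈ s, ∀ y ∈ s, dist x y < ξ) : HasBesicovitchCovering s :=
  ⟨⟨_, _, by norm_num, hdir.isEmpty_satelliteConfig hη' hs⟩⟩

/-- The empty family is a packing. -/
theorem IsPackingOf.empty {X : Type*} [MetricSpace X] (U : Set X) (δ : ℝ) :
    IsPackingOf U δ ∅ :=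
  ⟨countable_empty, fun _ h => h.elim, fun _ h => h.elim⟩

theorem IsPackingOf.pairwiseDisjoint {X : Type*} [MetricSpace X] {U : Set X} {δ : ℝ}
    {P : Set (X × ℝ)} (hP : IsPackingOf U δ P) :
    P.PairwiseDisjoint fun p => closedBall p.1 p.2 :=
  hP.2.2

/-- Packings of pairwise disjoint subsets of `U` can be merged into a packing of `U`. -/
theorem IsPackingOf.iUnion {X : Type*} [MetricSpace X] {U : Set X} {δ : ℝ} {V : ℕ → Set X}
    {Q : ℕ → Set (X × ℝ)} (hVU : ∀ k, V k ⊆ U) (hV : Pairwise (Function.onFun Disjoint V))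
    (hQ : ∀ k, IsPackingOf (V k) δ (Q k)) : IsPackingOf U δ (⋃ k, Q k) := by
  refine ⟨countable_iUnion fun k => (hQ k).1, ?_, ?_⟩
  · intro p hp
    obtain ⟨k, hk⟩ := mem_iUnion.1 hp
    obtain ⟨h1, h2, h3⟩ := (hQ k).2.1 p hk
    exact ⟨h1, h2, h3.trans (hVU k)⟩
  · intro p hp p' hp' hne
    obtain ⟨k, hk⟩ := mem_iUnion.1 hp
    obtain ⟨l, hl⟩ := mem_iUnion.1 hp'
    by_cases hkl : k = l
    · subst hkl
      exact (hQ k).2.2 hk hl hne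
    · exact (hV hkl).mono ((hQ k).2.1 p hk).2.2 ((hQ l).2.1 p' hl).2.2

/-- Measurable covering by packings, inside an open set whose induced metric has the
Besicovitch covering property. -/
theorem exists_packing_covering_ae_of_hasBesicovitchCovering {X : Type*} [MetricSpace X]
    [MeasurableSpace X] [BorelSpace X] [SecondCountableTopology X] (μ : Measure X)
    [IsFiniteMeasure μ] {V : Set X} (hV : IsOpen V) [HasBesicovitchCovering V]
    (f : X → Set ℝ) {S : Set X} (hSV : S ⊆ V)
    (hf : ∀ x ∈ S, ∀ δ > 0, (f x ∩ Ioo 0 δ).Nonempty) {δ : ℝ} (hδ : 0 < δ) :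
    ∃ P, IsPackingOf V δ P ∧ (∀ p ∈ P, p.2 ∈ f p.1) ∧
      μ (S \ ⋃ p ∈ P, closedBall p.1 p.2) = 0 := by
  have hR : ∀ x : V, ∃ R > 0, ball (x : X) R ⊆ V := fun x => Metric.isOpen_iff.1 hV x x.2
  choose R hR0 hRV using hR
  obtain ⟨t, r, htc, -, htr, hcov, hdisj⟩ :=
    Besicovitch.exists_disjoint_closedBall_covering_ae (μ.comap ((↑) : V → X))
      (fun x : V => f x) (((↑) : V → X) ⁻¹' S) (fun x hx => hf x hx) (fun x => min δ (R x))
      (fun x _ => lt_min hδ (hR0 x))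
  have hball : ∀ x ∈ t, closedBall (x : X) (r x) ⊆ V := fun x hx =>
    (closedBall_subset_ball ((htr x hx).2.2.trans_le (min_le_right _ _))).trans (hRV x)
  refine ⟨(fun x : V => ((x : X), r x)) '' t, ⟨htc.image _, ?_, ?_⟩, ?_, ?_⟩
  · rintro _ ⟨x, hx, rfl⟩
    exact ⟨(htr x hx).2.1, ((htr x hx).2.2.trans_le (min_le_left _ _)).le, hball x hx⟩
  · rintro _ ⟨x, hx, rfl⟩ _ ⟨y, hy, rfl⟩ hne
    have hxy : x ≠ y := fun h => hne (by rw [h])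
    refine Set.disjoint_left.2 fun z (hzx : z ∈ closedBall _ _) (hzy : z ∈ closedBall _ _) => ?_
    have hd : Disjoint (closedBall x (r x)) (closedBall y (r y)) := hdisj hx hy hxy
    exact Set.disjoint_left.1 hd (show (⟨z, hball x hx hzx⟩ : V) ∈ closedBall x (r x) from hzx) hzy
  · rintro _ ⟨x, hx, rfl⟩
    exact (htr x hx).1
  · rw [comap_subtype_coe_apply hV.measurableSet] at hcov
    refine measure_mono_null ?_ hcov
    rintro z ⟨hzS, hz⟩
    refine ⟨⟨z, hSV hzS⟩, ⟨hzS, fun h => hz ?_⟩, rfl⟩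
    obtain ⟨x, hx, hzx⟩ := mem_iUnion₂.1 h
    exact mem_iUnion₂.2 ⟨_, mem_image_of_mem _ hx, hzx⟩

/-- Measurable covering theorem in directionally limited spaces: a fine family of closed balls
contains packings covering almost all of the set of centers. -/
theorem DirLimited.exists_packing_covering_ae {X : Type*} [MetricSpace X]
    [MeasurableSpace X] [BorelSpace X] [TopologicalSpace.SeparableSpace X] {ξ η : ℝ} {ζ : ℕ}
    (hξ : 0 < ξ) (hη' : η ≤ 1 / 3) (hdir : DirLimited (Set.univ : Set X) ξ η ζ)
    (μ : Measure X) [SFinite μ] {U : Set X} (hU : IsOpen U)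
    (f : X → Set ℝ) {S : Set X} (hSU : S ⊆ U)
    (hf : ∀ x ∈ S, ∀ δ > 0, (f x ∩ Ioo 0 δ).Nonempty) {δ : ℝ} (hδ : 0 < δ) :
    ∃ P, IsPackingOf U δ P ∧ (∀ p ∈ P, p.2 ∈ f p.1) ∧
      μ (S \ ⋃ p ∈ P, closedBall p.1 p.2) = 0 := by
  obtain ⟨μ', _, hac, -⟩ := exists_isFiniteMeasure_absolutelyContinuous μ
  have : SecondCountableTopology X := UniformSpace.secondCountable_of_separable X
  rcases isEmpty_or_nonempty X with hX | hX
  · refine ⟨∅, .empty U δ, fun _ h => h.elim, ?_⟩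
    rw [Set.eq_empty_of_isEmpty (S \ _), measure_empty]
  have hrad : ∀ x : X, ∃ ρ ∈ Ioo (ξ / 4) (ξ / 2), μ' (sphere x ρ) = 0 := by
    intro x
    have hc : Set.Countable {ρ : ℝ | 0 < μ' (sphere x ρ)} := by
      refine Measure.countable_meas_pos_of_disjoint_iUnion
        (fun ρ => Metric.isClosed_sphere.measurableSet) fun ρ ρ' hne => ?_
      refine Set.disjoint_left.2 fun z hz hz' => hne ?_
      rw [← mem_sphere.1 hz, ← mem_sphere.1 hz']
    by_contra! h
    refine (mt Cardinal.Real.Ioo_countable_iff.1 (by linarith : ¬ ξ / 2 ≤ ξ / 4)) (hc.mono ?_)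
    exact fun ρ hρ => pos_iff_ne_zero.2 (h ρ hρ)
  choose ρ hρ hρ0 using hrad
  set x := TopologicalSpace.denseSeq X with hx
  set V : ℕ → Set X := fun k =>
    (U ∩ ball (x k) (ρ (x k))) \ ⋃ j ∈ Finset.range k, closedBall (x j) (ρ (x j)) with hVdef
  have hVo : ∀ k, IsOpen (V k) := fun k =>
    (hU.inter isOpen_ball).sdiff (isClosed_biUnion_finset fun j _ => isClosed_closedBall)
  have hVU : ∀ k, V k ⊆ U := fun k z hz => hz.1.1
  have hVd : Pairwise (Function.onFun Disjoint V) := by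
    have : ∀ j k, j < k → Disjoint (V j) (V k) := fun j k hjk =>
      Set.disjoint_left.2 fun z hz hz' => hz'.2 <|
        mem_iUnion₂.2 ⟨j, Finset.mem_range.2 hjk, ball_subset_closedBall hz.1.2⟩
    intro j k hjk
    rcases lt_or_gt_of_ne hjk with h | h
    · exact this j k h
    · exact (this k j h).symm
  have hVB : ∀ k, HasBesicovitchCovering (V k) := fun k => by
    refine hdir.hasBesicovitchCovering hη' fun y hy z hz => ?_
    have h1 := mem_ball.1 hy.1.2
    have h2 := mem_ball.1 hz.1.2
    have h3 := (hρ (x k)).2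
    have h4 := dist_triangle_right y z (x k)
    linarith
  have hQ : ∀ k, ∃ P, IsPackingOf (V k) δ P ∧ (∀ p ∈ P, p.2 ∈ f p.1) ∧
      μ' ((S ∩ V k) \ ⋃ p ∈ P, closedBall p.1 p.2) = 0 := fun k =>
    exists_packing_covering_ae_of_hasBesicovitchCovering μ' (hVo k) f inter_subset_right
      (fun y hy => hf y hy.1) hδ
  choose Q hQ1 hQ2 hQ3 using hQ
  refine ⟨⋃ k, Q k, .iUnion hVU hVd hQ1, ?_, hac ?_⟩
  · intro p hp
    obtain ⟨k, hk⟩ := mem_iUnion.1 hp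
    exact hQ2 k p hk
  · refine measure_mono_null (t := (⋃ k, sphere (x k) (ρ (x k))) ∪
      ⋃ k, ((S ∩ V k) \ ⋃ p ∈ Q k, closedBall p.1 p.2)) ?_ ?_
    · rintro z ⟨hzS, hz⟩
      by_cases hsph : ∃ k, z ∈ sphere (x k) (ρ (x k))
      · exact Or.inl (mem_iUnion.2 hsph)
      right
      push Not at hsph
      have hex : ∃ k, z ∈ closedBall (x k) (ρ (x k)) := by
        obtain ⟨k, hk⟩ := (TopologicalSpace.denseRange_denseSeq X).exists_dist_lt z
          (by positivity : 0 < ξ / 4)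
        exact ⟨k, mem_closedBall.2 (hk.le.trans (hρ (x k)).1.le)⟩
      classical
      have hk1 := Nat.find_spec hex
      have hk2 : ∀ j < Nat.find hex, z ∉ closedBall (x j) (ρ (x j)) :=
        fun j hj => Nat.find_min hex hj
      refine mem_iUnion.2 ⟨Nat.find hex, ⟨hzS, ⟨hSU hzS, ?_⟩, ?_⟩, fun h => hz ?_⟩
      · exact mem_ball.2 (lt_of_le_of_ne (mem_closedBall.1 hk1) (hsph _))
      · intro h
        obtain ⟨j, hj, hzj⟩ := mem_iUnion₂.1 h
        exact hk2 j (Finset.mem_range.1 hj) hzj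
      · obtain ⟨p, hp, hzp⟩ := mem_iUnion₂.1 h
        exact mem_iUnion₂.2 ⟨p, mem_iUnion.2 ⟨_, hp⟩, hzp⟩
    · exact measure_union_null (measure_iUnion_null fun k => hρ0 _) (measure_iUnion_null hQ3)

theorem IsPackingOf.tsum_measure_le {X : Type*} [MetricSpace X] [MeasurableSpace X]
    [BorelSpace X] {U : Set X} {δ : ℝ} {P : Set (X × ℝ)} (hP : IsPackingOf U δ P)
    (μ : Measure X) : ∑' p : P, μ (closedBall p.1.1 p.1.2) ≤ μ U := by
  rw [← measure_biUnion (f := fun p : X × ℝ => closedBall p.1 p.2) hP.1 hP.pairwiseDisjoint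
    fun p _ => isClosed_closedBall.measurableSet]
  exact measure_mono (iUnion₂_subset fun p hp => (hP.2.1 p hp).2.2)

/-- In a directionally limited space, the measure of a set of centers of a fine family of balls is
bounded by the sum of the measures of the balls of some packing. -/
theorem DirLimited.exists_packing_measure_le_tsum {X : Type*} [MetricSpace X]
    [MeasurableSpace X] [BorelSpace X] [TopologicalSpace.SeparableSpace X] {ξ η : ℝ} {ζ : ℕ}
    (hξ : 0 < ξ) (hη' : η ≤ 1 / 3) (hdir : DirLimited (Set.univ : Set X) ξ η ζ)
    (μ : Measure X) {U : Set X} (hU : IsOpen U) [SFinite (μ.restrict U)]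
    (f : X → Set ℝ) {S : Set X} (hSU : S ⊆ U)
    (hf : ∀ x ∈ S, ∀ δ > 0, (f x ∩ Ioo 0 δ).Nonempty) {δ : ℝ} (hδ : 0 < δ) :
    ∃ P, IsPackingOf U δ P ∧ (∀ p ∈ P, p.2 ∈ f p.1) ∧
      μ S ≤ ∑' p : P, μ (closedBall p.1.1 p.1.2) := by
  obtain ⟨P, hP, hPf, h0⟩ :=
    hdir.exists_packing_covering_ae hξ hη' (μ.restrict U) hU f hSU hf hδ
  refine ⟨P, hP, hPf, ?_⟩
  rw [Measure.restrict_apply' hU.measurableSet,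
    inter_eq_self_of_subset_left (sdiff_subset.trans hSU)] at h0
  calc μ S ≤ μ ((S \ ⋃ p ∈ P, closedBall p.1 p.2) ∪ ⋃ p ∈ P, closedBall p.1 p.2) :=
        measure_mono (by rw [sdiff_union_self]; exact subset_union_left)
    _ ≤ μ (S \ ⋃ p ∈ P, closedBall p.1 p.2) + μ (⋃ p ∈ P, closedBall p.1 p.2) :=
        measure_union_le _ _
    _ ≤ ∑' p : P, μ (closedBall p.1.1 p.1.2) := by
        rw [h0, zero_add]
        exact measure_biUnion_le μ hP.1 fun p : X × ℝ => closedBall p.1 p.2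

/-- A set of points around which `μ` is arbitrarily small with respect to `ν` on arbitrarily small
balls is `μ`-negligible. -/
theorem DirLimited.measure_eq_zero_of_frequently_le {X : Type*} [MetricSpace X]
    [MeasurableSpace X] [BorelSpace X] [TopologicalSpace.SeparableSpace X] {ξ η : ℝ} {ζ : ℕ}
    (hξ : 0 < ξ) (hη' : η ≤ 1 / 3) (hdir : DirLimited (Set.univ : Set X) ξ η ζ)
    {μ ν : Measure X} {U : Set X} (hU : IsOpen U) [SFinite (μ.restrict U)]
    (hν : ∀ s : Set X, IsBounded s → ν s < ⊤) {S : Set X} (hSU : S ⊆ U)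
    (hS : ∀ x ∈ S, ∀ ε : ℝ≥0∞, ε ≠ 0 → ∀ δ > 0, ∃ r ∈ Ioo (0 : ℝ) δ,
      μ (closedBall x r) ≤ ε * ν (closedBall x r)) : μ S = 0 := by
  rcases S.eq_empty_or_nonempty with rfl | ⟨x₀, -⟩
  · exact measure_empty
  have hpiece : ∀ m : ℕ, μ (S ∩ ball x₀ m) = 0 := by
    intro m
    set W := U ∩ ball x₀ m with hW
    have hWo : IsOpen W := hU.inter isOpen_ball
    have : SFinite (μ.restrict W) := by
      have : μ.restrict W = (μ.restrict U).restrict W := by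
        rw [Measure.restrict_restrict hWo.measurableSet,
          inter_eq_self_of_subset_left inter_subset_left]
      rw [this]; infer_instance
    have hνW : ν W < ⊤ := hν _ (isBounded_ball.subset inter_subset_right)
    have hle : ∀ n : ℕ, μ (S ∩ ball x₀ m) ≤ (n : ℝ≥0∞)⁻¹ * ν W := by
      intro n
      obtain ⟨P, hP, hPf, hle⟩ := hdir.exists_packing_measure_le_tsum hξ hη' μ hWo
        (fun x => {r | μ (closedBall x r) ≤ (n : ℝ≥0∞)⁻¹ * ν (closedBall x r)})
        (S := S ∩ ball x₀ m) (inter_subset_inter_left _ hSU) (fun x hx δ hδ => by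
          obtain ⟨r, hr, h⟩ := hS x hx.1 (n : ℝ≥0∞)⁻¹
            (ENNReal.inv_ne_zero.2 (ENNReal.natCast_ne_top n)) δ hδ
          exact ⟨r, h, hr⟩) one_pos
      calc _ ≤ _ := hle
        _ ≤ ∑' p : P, (n : ℝ≥0∞)⁻¹ * ν (closedBall p.1.1 p.1.2) :=
          ENNReal.tsum_le_tsum fun p => hPf p p.2
        _ = (n : ℝ≥0∞)⁻¹ * ∑' p : P, ν (closedBall p.1.1 p.1.2) := ENNReal.tsum_mul_left
        _ ≤ _ := by gcongr; exact hP.tsum_measure_le ν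
    have hlim : Tendsto (fun n : ℕ => (n : ℝ≥0∞)⁻¹ * ν W) atTop (𝓝 (0 * ν W)) :=
      ENNReal.Tendsto.mul_const ENNReal.tendsto_inv_nat_nhds_zero (Or.inr hνW.ne)
    rw [zero_mul] at hlim
    exact le_antisymm (ge_of_tendsto' hlim hle) zero_le
  refine measure_mono_null (t := ⋃ m : ℕ, S ∩ ball x₀ m) ?_ (measure_iUnion_null hpiece)
  intro z hz
  obtain ⟨m, hm⟩ := exists_nat_gt (dist z x₀)
  exact mem_iUnion.2 ⟨m, hz, mem_ball.2 hm⟩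

/-- If `μ` decays along small balls around `x` by a factor strictly better than the one
allowed by the asymptotic bound on `ν`, then `μ` is small with respect to `ν` there. -/
theorem AsympBounded.exists_measure_closedBall_le {X : Type*} [MetricSpace X]
    [MeasurableSpace X] {μ ν : Measure X} {α γ l : ℝ} (hα : α ∈ Ioo 0 1) (hγ : 1 ≤ γ)
    (hl : γ < l) (hν : AsympBounded ν α γ) {x : X} {r₀ : ℝ} (hr₀ : 0 < r₀)
    (hfin : μ (closedBall x r₀) < ⊤)
    (hbad : ∀ r ∈ Ioo 0 r₀, ENNReal.ofReal l * μ (closedBall x (α * r)) ≤ μ (closedBall x r))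
    {ε : ℝ≥0∞} (hε : ε ≠ 0) {δ : ℝ} (hδ : 0 < δ) :
    ∃ r ∈ Ioo (0 : ℝ) δ, μ (closedBall x r) ≤ ε * ν (closedBall x r) := by
  obtain ⟨l', hγl', hl'l⟩ := exists_between hl
  have hev : ∀ᶠ r in 𝓝[>] (0 : ℝ),
      ν (closedBall x r) / ν (closedBall x (α * r)) < ENNReal.ofReal l' :=
    eventually_lt_of_limsup_lt ((hν.2.2 x).trans_lt
      ((ENNReal.ofReal_lt_ofReal_iff (by linarith)).2 hγl'))
  obtain ⟨r₂, hr₂, hr₂'⟩ := (mem_nhdsGT_iff_exists_Ioo_subset).1 hev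
  have hr₂0 : 0 < r₂ := hr₂
  set r₁ := min r₀ r₂ / 2 with hr₁
  have hr₁0 : 0 < r₁ := by positivity
  have hr₁₀ : r₁ < r₀ := by have := min_le_left r₀ r₂; have := lt_min hr₀ hr₂0; linarith
  have hr₁₂ : r₁ < r₂ := by have := min_le_right r₀ r₂; have := lt_min hr₀ hr₂0; linarith
  have hspos : ∀ k : ℕ, 0 < α ^ k * r₁ := fun k => mul_pos (pow_pos hα.1 k) hr₁0
  have hsle : ∀ k : ℕ, α ^ k * r₁ ≤ r₁ := fun k =>
    mul_le_of_le_one_left hr₁0.le (pow_le_one₀ hα.1.le hα.2.le)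
  set L := ENNReal.ofReal l with hL
  set L' := ENNReal.ofReal l' with hL'
  have hL0 : L ≠ 0 := (ENNReal.ofReal_pos.2 (by linarith)).ne'
  have hL'0 : L' ≠ 0 := (ENNReal.ofReal_pos.2 (by linarith)).ne'
  have hLt : L ≠ ⊤ := ENNReal.ofReal_ne_top
  have hL't : L' ≠ ⊤ := ENNReal.ofReal_ne_top
  have hμk : ∀ k : ℕ, L ^ k * μ (closedBall x (α ^ k * r₁)) ≤ μ (closedBall x r₁) := by
    intro k
    induction k with
    | zero => simp
    | succ k ih =>
      refine le_trans ?_ ih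
      rw [pow_succ, mul_assoc, pow_succ' α, mul_assoc α]
      gcongr
      exact hbad _ ⟨hspos k, (hsle k).trans_lt hr₁₀⟩
  have hνk : ∀ k : ℕ, ν (closedBall x r₁) ≤ L' ^ k * ν (closedBall x (α ^ k * r₁)) := by
    intro k
    induction k with
    | zero => simp
    | succ k ih =>
      refine ih.trans ?_
      rw [pow_succ, mul_assoc, pow_succ' α, mul_assoc α]
      gcongr
      have h := hr₂' ⟨hspos k, (hsle k).trans_lt hr₁₂⟩
      exact (ENNReal.div_le_iff (hν.2.1 x _ (mul_pos hα.1 (hspos k))).ne'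
        (hν.1 _ isBounded_closedBall).ne).1 (le_of_lt h)
  have hM : μ (closedBall x r₁) ≠ ⊤ :=
    ((measure_mono (closedBall_subset_closedBall hr₁₀.le)).trans_lt hfin).ne
  have hm : 0 < ε * ν (closedBall x r₁) := ENNReal.mul_pos hε (hν.2.1 x _ hr₁0).ne'
  have hq1 : L' / L < 1 := ENNReal.div_lt_of_lt_mul (by
    rw [one_mul]; exact (ENNReal.ofReal_lt_ofReal_iff (by linarith)).2 hl'l)
  have hlim : Tendsto (fun k : ℕ => (L' / L) ^ k * μ (closedBall x r₁)) atTop (𝓝 0) := by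
    have := ENNReal.Tendsto.mul_const (ENNReal.tendsto_pow_atTop_nhds_zero_of_lt_one hq1)
      (Or.inr hM)
    rwa [zero_mul] at this
  have hslim : Tendsto (fun k : ℕ => α ^ k * r₁) atTop (𝓝 0) := by
    have := (tendsto_pow_atTop_nhds_zero_of_lt_one hα.1.le hα.2).mul_const r₁
    rwa [zero_mul] at this
  obtain ⟨k, hk1, hk2⟩ := ((hlim.eventually_lt_const hm).and
    (hslim.eventually_lt_const hδ)).exists
  refine ⟨α ^ k * r₁, ⟨hspos k, hk2⟩, ?_⟩
  have hLk0 : L ^ k ≠ 0 := pow_ne_zero _ hL0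
  have hLkt : L ^ k ≠ ⊤ := ENNReal.pow_ne_top hLt
  have hLk'0 : L' ^ k ≠ 0 := pow_ne_zero _ hL'0
  have hLk't : L' ^ k ≠ ⊤ := ENNReal.pow_ne_top hL't
  have hpow : L ^ k * (L' / L) ^ k = L' ^ k := by
    rw [← mul_pow, ENNReal.mul_div_cancel hL0 hLt]
  rw [← ENNReal.mul_le_mul_iff_right (a := L' ^ k * L ^ k) (mul_ne_zero hLk'0 hLk0)
    (ENNReal.mul_ne_top hLk't hLkt)]
  calc L' ^ k * L ^ k * μ (closedBall x (α ^ k * r₁))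
      = L' ^ k * (L ^ k * μ (closedBall x (α ^ k * r₁))) := mul_assoc _ _ _
    _ ≤ L' ^ k * μ (closedBall x r₁) := by gcongr; exact hμk k
    _ = L ^ k * ((L' / L) ^ k * μ (closedBall x r₁)) := by rw [← mul_assoc, hpow]
    _ ≤ L ^ k * (ε * ν (closedBall x r₁)) := by gcongr
    _ ≤ L ^ k * (ε * (L' ^ k * ν (closedBall x (α ^ k * r₁)))) := by gcongr; exact hνk k
    _ = L' ^ k * L ^ k * (ε * ν (closedBall x (α ^ k * r₁))) := by ring

/-- Around `μ`-almost every point, arbitrarily small balls have controlled `μ`-decay. -/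
theorem DirLimited.measure_decay_eq_zero {X : Type*} [MetricSpace X]
    [MeasurableSpace X] [BorelSpace X] [TopologicalSpace.SeparableSpace X] {ξ η : ℝ} {ζ : ℕ}
    (hξ : 0 < ξ) (hη' : η ≤ 1 / 3) (hdir : DirLimited (Set.univ : Set X) ξ η ζ)
    {μ ν : Measure X} {U : Set X} (hU : IsOpen U) [SFinite (μ.restrict U)]
    (hfin : ∀ x ∈ U, ∃ r > 0, μ (closedBall x r) < ⊤)
    {α γ l : ℝ} (hα : 0 < α ∧ α ≤ 1) (hγ : 1 ≤ γ) (hl : γ < l) (hν : AsympBounded ν α γ) :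
    μ {x ∈ U | ∃ r₀ > 0, ∀ r ∈ Ioo 0 r₀,
      ENNReal.ofReal l * μ (closedBall x (α * r)) < μ (closedBall x r)} = 0 := by
  refine hdir.measure_eq_zero_of_frequently_le hξ hη' hU hν.1 (fun x hx => hx.1) ?_
  rintro x ⟨hxU, r₀, hr₀, hbad⟩ ε hε δ hδ
  rcases hα.2.lt_or_eq with h | rfl
  · obtain ⟨r₁, hr₁, hr₁fin⟩ := hfin x hxU
    refine hν.exists_measure_closedBall_le ⟨hα.1, h⟩ hγ hl (lt_min hr₀ hr₁)
      ((measure_mono (closedBall_subset_closedBall (min_le_right _ _))).trans_lt hr₁fin)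
      (fun r hr => (hbad r ⟨hr.1, hr.2.trans_le (min_le_left _ _)⟩).le) hε hδ
  · have h1 := hbad (r₀ / 2) ⟨by positivity, by linarith⟩
    rw [one_mul] at h1
    refine absurd h1 (not_lt.2 ?_)
    exact le_mul_of_one_le_left zero_le (ENNReal.one_le_ofReal.2 (by linarith))

/-- Lower bound for packing sums on an open set on which `μ` is locally finite. -/
theorem DirLimited.measure_le_packPre {X : Type*} [MetricSpace X]
    [MeasurableSpace X] [BorelSpace X] [TopologicalSpace.SeparableSpace X] {ξ η : ℝ} {ζ : ℕ}
    (hξ : 0 < ξ) (hη' : η ≤ 1 / 3) (hdir : DirLimited (Set.univ : Set X) ξ η ζ)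
    {μ ν : Measure X} {U : Set X} (hU : IsOpen U)
    (hfin : ∀ x ∈ U, ∃ r > 0, μ (closedBall x r) < ⊤)
    {α γ l c R : ℝ} (hα : 0 < α ∧ α ≤ 1) (hγ : 1 ≤ γ) (hl : γ < l) (hν : AsympBounded ν α γ)
    (hc : 1 ≤ c) (hR : 0 < R) {q : X → ℝ → ℝ≥0∞}
    (hq : ∀ (x : X) (r : ℝ), 0 < r → r < R →
      ENNReal.ofReal (1 / c) * μ (closedBall x (α * r)) ≤ q x r)
    {δ : ℝ} (hδ : 0 < δ) : μ U ≤ ENNReal.ofReal (l * c) * packPre q δ U := by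
  have : SecondCountableTopology X := UniformSpace.secondCountable_of_separable X
  have : SFinite (μ.restrict U) := by
    choose! ρ hρ hρfin using hfin
    obtain ⟨T, hTU, hTc, hT⟩ := TopologicalSpace.isOpen_biUnion_countable U
      (fun x => ball x (ρ x)) fun x _ => isOpen_ball
    have : SigmaFinite (μ.restrict U) := by
      refine Measure.sigmaFinite_of_countable (S := insert Uᶜ ((fun x => ball x (ρ x)) '' T))
        ((hTc.image _).insert _) ?_ ?_
      · rintro _ (rfl | ⟨x, hx, rfl⟩)
        · simp [Measure.restrict_apply hU.measurableSet.compl]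
        · exact (Measure.restrict_apply_le _ _).trans_lt
            ((measure_mono ball_subset_closedBall).trans_lt (hρfin x (hTU hx)))
      · refine eq_univ_of_forall fun z => ?_
        by_cases hz : z ∈ U
        · have : z ∈ ⋃ x ∈ T, ball x (ρ x) := by
            rw [hT]; exact mem_iUnion₂.2 ⟨z, hz, mem_ball_self (hρ z hz)⟩
          obtain ⟨x, hx, hzx⟩ := mem_iUnion₂.1 this
          exact ⟨_, Or.inr (mem_image_of_mem _ hx), hzx⟩
        · exact ⟨_, Or.inl rfl, hz⟩
    infer_instance
  set L := ENNReal.ofReal l with hL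
  set bad : Set X := {x ∈ U | ∃ r₀ > 0, ∀ r ∈ Ioo 0 r₀,
      L * μ (closedBall x (α * r)) < μ (closedBall x r)} with hbad
  have hbad0 : μ bad = 0 := hdir.measure_decay_eq_zero hξ hη' hU hfin hα hγ hl hν
  obtain ⟨P, hP, hPf, hle⟩ := hdir.exists_packing_measure_le_tsum hξ hη' μ hU
    (fun x => {r | r < R ∧ μ (closedBall x r) ≤ L * μ (closedBall x (α * r))})
    (S := U \ bad) sdiff_subset (fun x hx δ hδ => by
      by_contra hne
      refine hx.2 ⟨hx.1, min δ R, lt_min hδ hR, fun r hr => ?_⟩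
      by_contra h
      exact hne ⟨r, ⟨hr.2.trans_le (min_le_right _ _), not_lt.1 h⟩,
        hr.1, hr.2.trans_le (min_le_left _ _)⟩) hδ
  have hq' : ∀ p ∈ P, μ (closedBall p.1 p.2) ≤ ENNReal.ofReal (l * c) * q p.1 p.2 := by
    intro p hp
    have h1 := hq p.1 p.2 (hP.2.1 p hp).1 (hPf p hp).1
    have h2 := (hPf p hp).2
    have hc1 : ENNReal.ofReal c * ENNReal.ofReal (1 / c) = 1 := by
      rw [← ENNReal.ofReal_mul (by linarith), mul_one_div_cancel (by linarith),
        ENNReal.ofReal_one]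
    calc μ (closedBall p.1 p.2) ≤ L * μ (closedBall p.1 (α * p.2)) := h2
      _ = L * (ENNReal.ofReal c * (ENNReal.ofReal (1 / c) * μ (closedBall p.1 (α * p.2)))) := by
        rw [← mul_assoc (ENNReal.ofReal c), hc1, one_mul]
      _ ≤ L * (ENNReal.ofReal c * q p.1 p.2) := by gcongr
      _ = ENNReal.ofReal (l * c) * q p.1 p.2 := by
        rw [ENNReal.ofReal_mul (by linarith), mul_assoc]
  calc μ U ≤ μ (U \ bad) := by rw [measure_sdiff_null hbad0]
    _ ≤ ∑' p : P, μ (closedBall p.1.1 p.1.2) := hle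
    _ ≤ ∑' p : P, ENNReal.ofReal (l * c) * q p.1.1 p.1.2 :=
      ENNReal.tsum_le_tsum fun p => hq' p p.2
    _ = ENNReal.ofReal (l * c) * ∑' p : P, q p.1.1 p.1.2 := ENNReal.tsum_mul_left
    _ ≤ _ := by gcongr; exact le_iSup₂_of_le P hP le_rfl

/-- A point where `μ` is not locally finite forces packing sums to be
infinite. -/
theorem packPre_eq_top {X : Type*} [MetricSpace X] [MeasurableSpace X]
    {μ : Measure X} {U : Set X} (hU : IsOpen U) {x : X} (hx : x ∈ U)
    (hinf : ∀ r > 0, μ (closedBall x r) = ⊤) {α c R : ℝ} (hα : 0 < α) (hc : 0 < c) (hR : 0 < R)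
    {q : X → ℝ → ℝ≥0∞}
    (hq : ∀ (x : X) (r : ℝ), 0 < r → r < R →
      ENNReal.ofReal (1 / c) * μ (closedBall x (α * r)) ≤ q x r)
    {δ : ℝ} (hδ : 0 < δ) : packPre q δ U = ⊤ := by
  obtain ⟨ρ, hρ, hρU⟩ := Metric.isOpen_iff.1 hU x hx
  set r := min δ (min R ρ) / 2 with hr
  have hm : 0 < min δ (min R ρ) := lt_min hδ (lt_min hR hρ)
  have hr0 : 0 < r := by positivity
  have hrm : r < min δ (min R ρ) := by linarith
  have hrδ : r < δ := hrm.trans_le (min_le_left _ _)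
  have hrR : r < R := hrm.trans_le ((min_le_right _ _).trans (min_le_left _ _))
  have hrρ : r < ρ := hrm.trans_le ((min_le_right _ _).trans (min_le_right _ _))
  have hP : IsPackingOf U δ {(x, r)} := by
    refine ⟨countable_singleton _, ?_, pairwise_singleton _ _⟩
    rintro _ rfl
    exact ⟨hr0, hrδ.le, (closedBall_subset_ball hrρ).trans hρU⟩
  have hqt : q x r = ⊤ := by
    have h := hq x r hr0 hrR
    rw [hinf _ (mul_pos hα hr0), ENNReal.mul_top] at h
    · exact top_le_iff.1 h
    · exact (ENNReal.ofReal_pos.2 (by positivity)).ne'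
  refine top_le_iff.1 (le_iSup₂_of_le {(x, r)} hP ?_)
  rw [tsum_singleton (x, r) fun p : X × ℝ => q p.1 p.2, hqt]

/-- stability: if `α_n, γ_n, C_n → 1`, `r_n → 0`, the space is separable and
directionally limited, each `ν_n` is asymptotically `(α_n,γ_n)`-bounded, `μ` is outer
regular, and `C_n⁻¹ μ(B_{α_n r}(x)) ≤ q(B_r(x)) ≤ C_n μ(B_r(x))` for all `0 < r < r_n`,
then the packing construction recovers `μ` exactly on Borel sets. -/
theorem stmt19 {X : Type*} [MetricSpace X] [MeasurableSpace X] [BorelSpace X]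
    [TopologicalSpace.SeparableSpace X]
    (ξ η : ℝ) (ζ : ℕ) (hξ : 0 < ξ) (hη : 0 < η) (hη' : η ≤ 1/3) (hζ : 0 < ζ)
    (hdir : DirLimited (Set.univ : Set X) ξ η ζ)
    (a g c R : ℕ → ℝ)
    (ha : ∀ n, 0 < a n ∧ a n ≤ 1) (hg : ∀ n, 1 ≤ g n) (hc : ∀ n, 1 ≤ c n)
    (hR : ∀ n, 0 < R n)
    (halim : Filter.Tendsto a Filter.atTop (𝓝 1))
    (hglim : Filter.Tendsto g Filter.atTop (𝓝 1))
    (hclim : Filter.Tendsto c Filter.atTop (𝓝 1))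
    (hRlim : Filter.Tendsto R Filter.atTop (𝓝 0))
    (ν : ℕ → Measure X) (hν : ∀ n, AsympBounded (ν n) (a n) (g n))
    (μ : Measure X) (hreg : μ.OuterRegular)
    (q : X → ℝ → ℝ≥0∞)
    (hq : ∀ (n : ℕ) (x : X) (r : ℝ), 0 < r → r < R n →
      ENNReal.ofReal (1 / c n) * μ (Metric.closedBall x (a n * r)) ≤ q x r ∧
      q x r ≤ ENNReal.ofReal (c n) * μ (Metric.closedBall x r)) :
    ∀ A : Set X, MeasurableSet A → packM q A = μ A := by
  have hlow : ∀ (U : Set X), IsOpen U → ∀ δ > 0, μ U ≤ packPre q δ U := by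
    intro U hU δ hδ
    by_cases hfin : ∀ x ∈ U, ∃ r > 0, μ (closedBall x r) < ⊤
    · set κ : ℕ → ℝ := fun n => (g n + 1 / ((n : ℝ) + 1)) * c n with hκ
      have hle : ∀ n, μ U ≤ ENNReal.ofReal (κ n) * packPre q δ U := fun n =>
        hdir.measure_le_packPre hξ hη' hU hfin (ha n) (hg n)
          (lt_add_of_pos_right _ (by positivity)) (hν n) (hc n) (hR n)
          (fun x r h0 h1 => (hq n x r h0 h1).1) hδ
      have hκlim : Tendsto κ atTop (𝓝 1) := by
        simpa [hκ] using (hglim.add tendsto_one_div_add_atTop_nhds_zero_nat).mul hclim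
      have hlim := ENNReal.Tendsto.mul_const (b := packPre q δ U)
        (ENNReal.tendsto_ofReal hκlim) (Or.inl (by simp))
      rw [ENNReal.ofReal_one, one_mul] at hlim
      exact ge_of_tendsto' hlim hle
    · push Not at hfin
      obtain ⟨x, hx, hinf⟩ := hfin
      rw [packPre_eq_top hU hx (fun r hr => top_le_iff.1 (hinf r hr)) (ha 0).1
        (one_pos.trans_le (hc 0)) (hR 0) (fun x r h0 h1 => (hq 0 x r h0 h1).1) hδ]
      exact le_top
  have hup : ∀ U : Set X, packOpen q U ≤ μ U := by
    intro U
    have hle : ∀ n, packOpen q U ≤ ENNReal.ofReal (c n) * μ U := by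
      intro n
      have hRn := hR n
      refine (iInf₂_le (R n / 2) (by positivity)).trans (iSup₂_le fun P hP => ?_)
      calc ∑' p : P, q p.1.1 p.1.2
          ≤ ∑' p : P, ENNReal.ofReal (c n) * μ (closedBall p.1.1 p.1.2) :=
            ENNReal.tsum_le_tsum fun p => by
              obtain ⟨h1, h2, -⟩ := hP.2.1 p p.2
              exact (hq n _ _ h1 (by linarith)).2
        _ = ENNReal.ofReal (c n) * ∑' p : P, μ (closedBall p.1.1 p.1.2) :=
            ENNReal.tsum_mul_left
        _ ≤ ENNReal.ofReal (c n) * μ U := by gcongr; exact hP.tsum_measure_le μ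
    have hlim := ENNReal.Tendsto.mul_const (b := μ U)
      (ENNReal.tendsto_ofReal hclim) (Or.inl (by simp))
    rw [ENNReal.ofReal_one, one_mul] at hlim
    exact ge_of_tendsto' hlim hle
  intro A hA
  refine le_antisymm ?_ ?_
  · refine le_of_forall_gt fun b hb => ?_
    obtain ⟨U, hAU, hU, hUb⟩ := A.exists_isOpen_lt_of_lt b hb
    exact ((iInf₂_le_of_le U hU (iInf_le _ hAU)).trans (hup U)).trans_lt hUb
  · exact le_iInf₂ fun U hU => le_iInf fun hAU =>
      (measure_mono hAU).trans (le_iInf₂ fun δ hδ => hlow U hU δ hδ)
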